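/- Suppose K is of type B with constant m. Let n ≥ 1, a ∈ K*, A = K[X]/(X^{2^n} − a) with ḡ the image of X, s = H_n(a), and suppose m < s ≤ n; write a = b^{2^s} with b ∈ K*. Then the minimal idempotents of A are exactly the elements e_i = (1/2^s)·Σ_{j=0}^{2^s−1} (b^{−1}·ε_m^{−i}·ḡ^{2^{n−s}})^j for i = 0, 1, …, 2^m − 1, together with the elements e_{r,i} = (1/2^{s−r})·Σ_{j=0}^{2^{s−r}−1} (b^{−2^r}·ε_m^{−1}·ε_{m−1}^{−i}·ḡ^{2^{n−s+r}})^j for r = 1, 2, …, s − m and i = 0, 1, …, 2^{m−1} − 1. -/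

import Mathlib

noncomputable section

/-- `x ∈ K̄` lies in (the image of) the base field `K`. -/
def InK (K : Type*) [Field K] (x : AlgebraicClosure K) : Prop :=
  x ∈ Set.range (algebraMap K (AlgebraicClosure K))

/-- Type A: `ε₂ ∈ K` and `εₙ ∈ K` for every `n`. -/
def TypeA (K : Type*) [Field K] (ε : ℕ → AlgebraicClosure K) : Prop :=
  InK K (ε 2) ∧ ∀ n : ℕ, InK K (ε n)

/-- Type B: `ε₂ ∈ K` and there is a unique `m ≥ 2` with `ε_m ∈ K`, `ε_{m+1} ∉ K`. -/
def TypeB (K : Type*) [Field K] (ε : ℕ → AlgebraicClosure K) : Prop :=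
  InK K (ε 2) ∧ ∃! m : ℕ, 2 ≤ m ∧ InK K (ε m) ∧ ¬InK K (ε (m + 1))

/-- Type C: `ε₂ ∉ K` and `εₙ + εₙ⁻¹ ∈ K` for every `n`. -/
def TypeC (K : Type*) [Field K] (ε : ℕ → AlgebraicClosure K) : Prop :=
  ¬InK K (ε 2) ∧ ∀ n : ℕ, InK K (ε n + (ε n)⁻¹)

/-- Type D: `ε₂ ∉ K` and there is a unique `m ≥ 2` with `ε_m + ε_m⁻¹ ∈ K`,
`ε_{m+1} + ε_{m+1}⁻¹ ∉ K` and `ε_{m+1} - ε_{m+1}⁻¹ ∉ K`. -/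
def TypeD (K : Type*) [Field K] (ε : ℕ → AlgebraicClosure K) : Prop :=
  ¬InK K (ε 2) ∧ ∃! m : ℕ, 2 ≤ m ∧ InK K (ε m + (ε m)⁻¹) ∧
    ¬InK K (ε (m + 1) + (ε (m + 1))⁻¹) ∧ ¬InK K (ε (m + 1) - (ε (m + 1))⁻¹)

/-- Type E: `ε₂ ∉ K` and there is a unique `m ≥ 3` with `ε_m - ε_m⁻¹ ∈ K`. -/
def TypeE (K : Type*) [Field K] (ε : ℕ → AlgebraicClosure K) : Prop :=
  ¬InK K (ε 2) ∧ ∃! m : ℕ, 3 ≤ m ∧ InK K (ε m - (ε m)⁻¹)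

/-- Type B with constant `m`. -/
def TypeBc (K : Type*) [Field K] (ε : ℕ → AlgebraicClosure K) (m : ℕ) : Prop :=
  InK K (ε 2) ∧ 2 ≤ m ∧ InK K (ε m) ∧ ¬InK K (ε (m + 1))

/-- Type D with constant `m`. -/
def TypeDc (K : Type*) [Field K] (ε : ℕ → AlgebraicClosure K) (m : ℕ) : Prop :=
  ¬InK K (ε 2) ∧ 2 ≤ m ∧ InK K (ε m + (ε m)⁻¹) ∧
    ¬InK K (ε (m + 1) + (ε (m + 1))⁻¹) ∧ ¬InK K (ε (m + 1) - (ε (m + 1))⁻¹)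

/-- Type E with constant `m`. -/
def TypeEc (K : Type*) [Field K] (ε : ℕ → AlgebraicClosure K) (m : ℕ) : Prop :=
  ¬InK K (ε 2) ∧ 3 ≤ m ∧ InK K (ε m - (ε m)⁻¹)

/-- `a ∈ K_s = K* ∩ (K(ε₂)*)^{2^s}`: `a = α^{2^s}` for some `α ∈ K(ε₂)*`. -/
def MemKs (K : Type*) [Field K] (ε : ℕ → AlgebraicClosure K) (s : ℕ) (a : K) : Prop :=
  ∃ α : AlgebraicClosure K, α ∈ IntermediateField.adjoin K {ε 2} ∧ α ≠ 0 ∧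
    algebraMap K (AlgebraicClosure K) a = α ^ 2 ^ s

/-- A minimal idempotent of a commutative ring: a nonzero idempotent which is not
the sum of two nonzero orthogonal idempotents. -/
def IsMinIdem {A : Type*} [CommRing A] (e : A) : Prop :=
  e ≠ 0 ∧ e * e = e ∧
    ¬∃ e₁ e₂ : A, e₁ ≠ 0 ∧ e₂ ≠ 0 ∧ e₁ * e₁ = e₁ ∧ e₂ * e₂ = e₂ ∧
      e₁ * e₂ = 0 ∧ e = e₁ + e₂

open Polynomial in
/-- If `-1` is a square in `K` and `c` is not, then `X ^ 2 ^ k - c` is irreducible. -/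
theorem irreducible_X_pow_two_pow_sub_C.{u} (k : ℕ) {K : Type u} [Field K] (c : K)
    (hi : IsSquare (-1 : K)) (hc : ¬IsSquare c) : Irreducible (X ^ 2 ^ k - C c : K[X]) := by
  induction k generalizing K with
  | zero => simpa using irreducible_X_sub_C c
  | succ k ih =>
    rw [pow_succ]
    refine X_pow_mul_sub_C_irreducible
      (X_pow_sub_C_irreducible_of_prime Nat.prime_two fun d hd => hc ⟨d, by rw [← hd, sq]⟩) ?_
    intro E _ _ x hx
    have hxi : IsIntegral K x := not_not.mp fun h => by
      simpa only [degree_zero, degree_X_pow_sub_C two_pos,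
        WithBot.natCast_ne_bot] using congr_arg degree (hx.symm.trans (dif_neg h))
    refine ih _ ?_ ?_
    · simpa using hi.map (algebraMap K (IntermediateField.adjoin K {x}))
    · rintro ⟨y, hy⟩
      have hnorm := congr_arg (Algebra.norm K) hy
      rw [map_mul, ← IntermediateField.adjoin.powerBasis_gen hxi,
        Algebra.PowerBasis.norm_gen_eq_coeff_zero_minpoly] at hnorm
      simp only [IntermediateField.adjoin.powerBasis_gen, IntermediateField.minpoly_gen, hx,
        coeff_sub, coeff_X_pow, coeff_C_zero, IntermediateField.adjoin.powerBasis_dim,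
        natDegree_X_pow_sub_C] at hnorm
      have hsq : IsSquare (-c) := ⟨Algebra.norm K y, by rw [← hnorm]; norm_num⟩
      exact hc (by simpa using hi.mul hsq)

/-- A family of minimal idempotents annihilated only by `0` contains every minimal idempotent. -/
theorem isMinIdem_iff_of_annihilator_eq_zero {A : Type*} [CommRing A] {P : A → Prop}
    (hP : ∀ E, P E → IsMinIdem E) (hann : ∀ e : A, (∀ E, P E → e * E = 0) → e = 0) (e : A) :
    IsMinIdem e ↔ P e := by
  refine ⟨fun he => ?_, hP e⟩
  obtain ⟨he0, hee, hemin⟩ := he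
  obtain ⟨E, hPE, hE⟩ : ∃ E, P E ∧ e * E ≠ 0 := by
    by_contra! h
    exact he0 (hann e h)
  obtain ⟨-, hEE, hEmin⟩ := hP E hPE
  have h1 : e * (1 - E) = 0 := by
    by_contra h
    exact hemin ⟨e * E, e * (1 - E), hE, h, by linear_combination (E * E) * hee + e * hEE,
      by linear_combination (1 - E) ^ 2 * hee + e * hEE,
      by linear_combination (-e * e) * hEE, by ring⟩
  have h2 : (1 - e) * E = 0 := by
    by_contra h
    exact hEmin ⟨e * E, (1 - e) * E, hE, h, by linear_combination (E * E) * hee + e * hEE,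
      by linear_combination (1 - e) ^ 2 * hEE + E * hee,
      by linear_combination (-E * E) * hee, by ring⟩
  rwa [show e = E by linear_combination h1 - h2]

open Polynomial in
/-- Modulo `f`, an element congruent to `1` modulo an irreducible factor `q` of `f` and
annihilated by `q` is a minimal idempotent, whose annihilator consists of multiples of `q`. -/
theorem isMinIdem_of_irreducible_dvd {K : Type*} [Field K] {f q : K[X]} (hq : Irreducible q)
    (hqf : q ∣ f) {E : AdjoinRoot f} (hE : AdjoinRoot.mk f q * E = 0)
    (hE1 : AdjoinRoot.mk f q ∣ E - 1) :
    IsMinIdem E ∧ ∀ p : K[X], AdjoinRoot.mk f p * E = 0 → q ∣ p := by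
  obtain ⟨h, hh⟩ := hE1
  have key : ∀ p : K[X], AdjoinRoot.mk f p * E = 0 → q ∣ p := by
    intro p hp
    obtain ⟨h', rfl⟩ := AdjoinRoot.mk_surjective h
    have h0 : AdjoinRoot.mk f (p + p * q * h') = 0 := by
      simp only [map_add, map_mul]
      linear_combination hp - AdjoinRoot.mk f p * hh
    have h1 := hqf.trans (AdjoinRoot.mk_eq_zero.mp h0)
    exact (dvd_add_left ((dvd_mul_left q p).mul_right h')).mp h1
  refine ⟨⟨?_, by linear_combination E * hh + h * hE, ?_⟩, key⟩
  · intro h0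
    exact hq.not_isUnit (isUnit_of_dvd_one (key 1 (by rw [h0, mul_zero])))
  · rintro ⟨e₁, e₂, h1, h2, h11, h22, h12, rfl⟩
    obtain ⟨p₁, rfl⟩ := AdjoinRoot.mk_surjective e₁
    obtain ⟨p₂, rfl⟩ := AdjoinRoot.mk_surjective e₂
    have hdvd : q ∣ p₁ * p₂ := by
      rw [← map_mul] at h12
      exact hqf.trans (AdjoinRoot.mk_eq_zero.mp h12)
    rcases hq.prime.dvd_or_dvd hdvd with ⟨t, rfl⟩ | ⟨t, rfl⟩
    · simp only [map_mul] at *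
      exact h1 (by linear_combination (AdjoinRoot.mk f t) * hE - h11 - h12)
    · simp only [map_mul] at *
      exact h2 (by linear_combination (AdjoinRoot.mk f t) * hE - h22 - h12)

open Polynomial in
/-- The averaged geometric sum attached to an irreducible factor `X ^ M - c` of `X ^ D - a`,
where `D = M * N` and `a = c ^ N`, is a minimal idempotent of `K[X] / (X ^ D - a)`. -/
theorem isMinIdem_geom_sum {K : Type*} [Field K] {M N D : ℕ} {a c : K} (hD : D = M * N)
    (hac : a = c ^ N) (hc : c ≠ 0) (hN : (N : K) ≠ 0) (hirr : Irreducible (X ^ M - C c))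
    {E : AdjoinRoot (X ^ D - C a)}
    (hE : E = algebraMap K _ (1 / N) * ∑ j ∈ Finset.range N,
      (algebraMap K (AdjoinRoot (X ^ D - C a)) c⁻¹ * AdjoinRoot.root (X ^ D - C a) ^ M) ^ j) :
    IsMinIdem E ∧
      ∀ p : K[X], AdjoinRoot.mk (X ^ D - C a) p * E = 0 → X ^ M - C c ∣ p := by
  set φ := algebraMap K (AdjoinRoot (X ^ D - C a))
  set g := AdjoinRoot.root (X ^ D - C a)
  set Z := φ c⁻¹ * g ^ M with hZ
  have hcc : φ c * φ c⁻¹ = 1 := by rw [← map_mul, mul_inv_cancel₀ hc, map_one]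
  have hNN : φ (1 / N) * (N : AdjoinRoot (X ^ D - C a)) = 1 := by
    rw [← map_natCast φ, ← map_mul, one_div, inv_mul_cancel₀ hN, map_one]
  have hgD : g ^ D = φ a := by
    have h0 := AdjoinRoot.mk_self (f := X ^ D - C a)
    simp only [map_sub, map_pow, AdjoinRoot.mk_X, AdjoinRoot.mk_C] at h0
    exact sub_eq_zero.mp h0
  have hZN : Z ^ N = 1 := by
    have hφa : φ a = φ c ^ N := by rw [← map_pow, ← hac]
    rw [hZ, mul_pow, ← pow_mul, ← hD, hgD, hφa, ← mul_pow, mul_comm, hcc, one_pow]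
  have hq : AdjoinRoot.mk (X ^ D - C a) (X ^ M - C c) = φ c * (Z - 1) := by
    simp only [map_sub, map_pow, AdjoinRoot.mk_X, AdjoinRoot.mk_C]
    rw [hZ, mul_sub, ← mul_assoc, hcc, one_mul, mul_one]
    rfl
  refine isMinIdem_of_irreducible_dvd hirr ?_ ?_ ?_
  · rw [hD, hac, C_pow, pow_mul]
    exact sub_dvd_pow_sub_pow _ _ N
  · have hgeom := geom_sum_mul Z N
    rw [hq, hE]
    linear_combination (φ c * φ (1 / N)) * (hgeom + hZN)
  · have hsum : E - 1 = φ (1 / N) * ∑ j ∈ Finset.range N, (Z ^ j - 1) := by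
      rw [Finset.sum_sub_distrib, mul_sub, hE, Finset.sum_const, Finset.card_range, nsmul_one, hNN]
    have hdvd : Z - 1 ∣ E - 1 := by
      rw [hsum]
      refine Dvd.dvd.mul_left (Finset.dvd_sum fun j _ => ?_) _
      simpa using sub_dvd_pow_sub_pow Z 1 j
    rw [hq]
    have hu : IsUnit (φ c) := IsUnit.of_mul_eq_one _ hcc
    exact hu.mul_left_dvd.mpr hdvd

open Polynomial in
/-- A polynomial vanishing at every root of `X ^ D - a` in the algebraic closure is divisible by
it, provided `D` and `a` are nonzero in `K`. -/
theorem X_pow_sub_C_dvd_of_forall_root {K : Type*} [Field K] {D : ℕ} {a : K} (hD : (D : K) ≠ 0)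
    (ha : a ≠ 0) {p : K[X]}
    (h : ∀ x : AlgebraicClosure K, x ^ D = algebraMap K _ a → aeval x p = 0) :
    X ^ D - C a ∣ p := by
  by_cases hp : p = 0
  · exact hp ▸ dvd_zero _
  have hD0 : 0 < D := Nat.pos_of_ne_zero fun h0 => hD (by simp [h0])
  have hsep : (X ^ D - C a).Separable := separable_X_pow_sub_C a hD ha
  rw [← map_dvd_map' (algebraMap K (AlgebraicClosure K)),
    IsAlgClosed.dvd_iff_roots_le_roots (map_ne_zero (X_pow_sub_C_ne_zero hD0 a)) (map_ne_zero hp),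
    Multiset.le_iff_subset (nodup_roots hsep.map)]
  intro x hx
  rw [mem_roots (map_ne_zero hp), IsRoot.def, eval_map_algebraMap]
  refine h x ?_
  rw [mem_roots (map_ne_zero (X_pow_sub_C_ne_zero hD0 a)), IsRoot.def] at hx
  simpa [sub_eq_zero] using hx

/-- For a primitive `2 ^ m`-th root of unity `ζ` with `m ≥ 1`, a root of unity `y` of order
dividing `2 ^ s` is a power of `ζ`, or some `y ^ 2 ^ r` with `1 ≤ r ≤ s - m` is an odd power
of `ζ`. -/
theorem exists_pow_two_pow_eq_primitiveRoot_pow {L : Type*} [Field L] {m s : ℕ} (hm : 1 ≤ m)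
    (hms : m ≤ s) {ζ y : L} (hζ : IsPrimitiveRoot ζ (2 ^ m)) (hy : y ^ 2 ^ s = 1) :
    (∃ i < 2 ^ m, y = ζ ^ i) ∨
      ∃ r, 1 ≤ r ∧ r ≤ s - m ∧ ∃ i < 2 ^ (m - 1), y ^ 2 ^ r = ζ ^ (2 * i + 1) := by
  classical
  have hex : ∃ r, (y ^ 2 ^ r) ^ 2 ^ m = 1 :=
    ⟨s - m, by rw [← pow_mul, ← pow_add, Nat.sub_add_cancel hms, hy]⟩
  have hspec := Nat.find_spec hex
  have hle : Nat.find hex ≤ s - m :=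
    Nat.find_min' hex (by rw [← pow_mul, ← pow_add, Nat.sub_add_cancel hms, hy])
  have hmin := fun k => Nat.find_min hex (m := k)
  generalize Nat.find hex = r at hspec hle hmin
  obtain ⟨i, hi, hiy⟩ := hζ.eq_pow_of_pow_eq_one hspec
  rcases Nat.eq_zero_or_pos r with rfl | hr
  · exact Or.inl ⟨i, hi, by simpa using hiy.symm⟩
  · refine Or.inr ⟨r, hr, hle, i / 2, ?_, ?_⟩
    · have : 2 ^ m = 2 ^ (m - 1) * 2 := by rw [← pow_succ, Nat.sub_add_cancel hm]
      omega
    · rcases Nat.even_or_odd' i with ⟨k, rfl | rfl⟩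
      · refine absurd ?_ (hmin (r - 1) (by omega))
        obtain ⟨r, rfl⟩ : ∃ t, r = t + 1 := ⟨r - 1, by omega⟩
        obtain ⟨m, rfl⟩ : ∃ t, m = t + 1 := ⟨m - 1, by omega⟩
        rw [Nat.add_sub_cancel, ← pow_mul, ← pow_add, show r + (m + 1) = r + 1 + m by omega,
          pow_add, pow_mul, ← hiy, ← pow_mul, mul_right_comm, ← pow_succ', pow_mul,
          hζ.pow_eq_one, one_pow]
      · rw [← hiy]
        congr 1
        omega

/-- Theorem 2, case 2): `K` of type B with constant `m` and `m < s ≤ n`.  The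
minimal idempotents of `A = K[X]/(X^{2^n} - a)` are exactly
`e_i = (1/2^s)·Σ_j (b⁻¹·ε_m⁻ⁱ·ḡ^{2^{n-s}})^j`, `i = 0, …, 2^m - 1`, together with
`e_{r,i} = (1/2^{s-r})·Σ_j (b^{-2^r}·ε_m⁻¹·ε_{m-1}⁻ⁱ·ḡ^{2^{n-s+r}})^j`,
`r = 1, …, s - m`, `i = 0, …, 2^{m-1} - 1`. -/
theorem stmt_14 (K : Type*) [Field K] (h2 : (2 : K) ≠ 0)
    (ε : ℕ → AlgebraicClosure K)
    (hprim : ∀ n : ℕ, IsPrimitiveRoot (ε n) (2 ^ n))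
    (hcomp : ∀ n : ℕ, ε (n + 1) ^ 2 = ε n)
    (m : ℕ) (hBm : TypeBc K ε m)
    (n : ℕ) (hn : 1 ≤ n) (a : K) (ha : a ≠ 0)
    -- `s = H_n(a)`:
    (s : ℕ) (hsn : s ≤ n) (hmem : MemKs K ε s a)
    (hmax : ∀ t : ℕ, t ≤ n → MemKs K ε t a → t ≤ s)
    (hms : m < s)
    (b : K) (hb : b ≠ 0) (hab : a = b ^ 2 ^ s)
    -- `ḡ` is the image of `X` in `A = K[X]/(X^{2^n} - a)`:
    (g : AdjoinRoot (Polynomial.X ^ 2 ^ n - Polynomial.C a))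
    (hg : g = AdjoinRoot.root (Polynomial.X ^ 2 ^ n - Polynomial.C a))
    (φ : K →+* AdjoinRoot (Polynomial.X ^ 2 ^ n - Polynomial.C a))
    (hφ : φ = algebraMap K (AdjoinRoot (Polynomial.X ^ 2 ^ n - Polynomial.C a))) :
    ∃ wm wm1 : K,
      algebraMap K (AlgebraicClosure K) wm = ε m ∧
      algebraMap K (AlgebraicClosure K) wm1 = ε (m - 1) ∧
      ∀ e : AdjoinRoot (Polynomial.X ^ 2 ^ n - Polynomial.C a),
        IsMinIdem e ↔
          ((∃ i : ℕ, i < 2 ^ m ∧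
            e = φ (1 / 2 ^ s) *
              ∑ j ∈ Finset.range (2 ^ s), (φ (b⁻¹ * wm⁻¹ ^ i) * g ^ 2 ^ (n - s)) ^ j) ∨
          (∃ r : ℕ, 1 ≤ r ∧ r ≤ s - m ∧ ∃ i : ℕ, i < 2 ^ (m - 1) ∧
            e = φ (1 / 2 ^ (s - r)) *
              ∑ j ∈ Finset.range (2 ^ (s - r)),
                (φ (b⁻¹ ^ 2 ^ r * wm⁻¹ * wm1⁻¹ ^ i) * g ^ 2 ^ (n - s + r)) ^ j)) := by
  obtain ⟨-, hm2, ⟨wm, hwm⟩, hnot⟩ := hBm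
  subst hg hφ
  set ι := algebraMap K (AlgebraicClosure K) with hι
  have hιinj : Function.Injective ι := ι.injective
  have hwm1 : ι (wm ^ 2) = ε (m - 1) := by
    rw [map_pow, hwm, ← hcomp (m - 1), Nat.sub_add_cancel (by omega)]
  have hwprim : IsPrimitiveRoot wm (2 ^ m) :=
    IsPrimitiveRoot.of_map_of_injective (hwm ▸ hprim m) hιinj
  have hwm0 : wm ≠ 0 := hwprim.ne_zero (by positivity)
  have hneg : IsSquare (-1 : K) := by
    refine ⟨wm ^ 2 ^ (m - 2), ?_⟩
    have h := hwprim.pow (a := 2 ^ (m - 1)) (b := 2) (by positivity)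
      (by rw [← pow_succ, Nat.sub_add_cancel (by omega)])
    rw [← pow_add, ← two_mul, ← pow_succ', show m - 2 + 1 = m - 1 by omega,
      h.eq_neg_one_of_two_right]
  have hpow2 : ∀ k : ℕ, ((2 ^ k : ℕ) : K) ≠ 0 := fun k => by
    rw [Nat.cast_pow, Nat.cast_ofNat]
    exact pow_ne_zero k h2
  have hwnsq : ¬IsSquare wm := by
    rintro ⟨d, hd⟩
    have h : ι d ^ 2 = ε (m + 1) ^ 2 := by rw [hcomp, ← hwm, hd, map_mul, sq]
    rcases sq_eq_sq_iff_eq_or_eq_neg.mp h with h | h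
    · exact hnot ⟨d, h⟩
    · exact hnot ⟨-d, by rw [map_neg, h, neg_neg]⟩
  have hwpow : ∀ k : ℕ, m ≤ k → wm ^ 2 ^ k = 1 := fun k hk =>
    (hwprim.pow_eq_one_iff_dvd _).mpr (pow_dvd_pow 2 hk)
  have hirr1 : ∀ i : ℕ, Irreducible (Polynomial.X ^ 2 ^ (n - s) - Polynomial.C (b * wm ^ i)) := by
    intro i
    rcases hsn.eq_or_lt with rfl | hlt
    · simpa using Polynomial.irreducible_X_sub_C (b * wm ^ i)
    · refine irreducible_X_pow_two_pow_sub_C _ _ hneg ?_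
      rintro ⟨d, hd⟩
      have hd0 : d ≠ 0 := by
        rintro rfl
        exact mul_ne_zero hb (pow_ne_zero i hwm0) (by simpa using hd)
      have had : a = d ^ 2 ^ (s + 1) := by
        rw [pow_succ', pow_mul, sq, ← hd, mul_pow, ← hab, pow_right_comm, hwpow s hms.le, one_pow,
          mul_one]
      have := hmax (s + 1) hlt ⟨ι d, IntermediateField.algebraMap_mem _ d,
        (map_ne_zero ι).mpr hd0, by rw [had, map_pow]⟩
      omega
  have hirr2 : ∀ r i : ℕ, 1 ≤ r → Irreducible
      (Polynomial.X ^ 2 ^ (n - s + r) - Polynomial.C (b ^ 2 ^ r * wm ^ (2 * i + 1))) := by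
    intro r i hr
    refine irreducible_X_pow_two_pow_sub_C _ _ hneg ?_
    rintro ⟨d, hd⟩
    refine hwnsq ⟨d / (b ^ 2 ^ (r - 1) * wm ^ i), ?_⟩
    obtain ⟨r, rfl⟩ : ∃ t, r = t + 1 := ⟨r - 1, by omega⟩
    rw [Nat.add_sub_cancel, div_mul_div_comm, ← hd]
    field_simp
    ring
  have hmin1 : ∀ i : ℕ, _ := fun i =>
    isMinIdem_geom_sum (M := 2 ^ (n - s)) (N := 2 ^ s) (D := 2 ^ n) (a := a) (c := b * wm ^ i)
      (by rw [← pow_add, Nat.sub_add_cancel hsn])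
      (by rw [mul_pow, ← hab, pow_right_comm, hwpow s hms.le, one_pow, mul_one])
      (mul_ne_zero hb (pow_ne_zero i hwm0)) (hpow2 s) (hirr1 i) rfl
  have hmin2 : ∀ r i : ℕ, 1 ≤ r → r ≤ s - m → _ := fun r i hr hrs =>
    isMinIdem_geom_sum (M := 2 ^ (n - s + r)) (N := 2 ^ (s - r)) (D := 2 ^ n) (a := a)
      (c := b ^ 2 ^ r * wm ^ (2 * i + 1))
      (by rw [← pow_add]; congr 1; omega)
      (by rw [mul_pow, ← pow_mul, ← pow_add, Nat.add_sub_cancel' (by omega), ← hab, pow_right_comm,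
        hwpow (s - r) (by omega), one_pow, mul_one])
      (mul_ne_zero (pow_ne_zero _ hb) (pow_ne_zero _ hwm0)) (hpow2 (s - r)) (hirr2 r i hr) rfl
  have hc1 : ∀ i : ℕ, b⁻¹ * wm⁻¹ ^ i = (b * wm ^ i)⁻¹ := fun i => by
    rw [mul_inv, inv_pow]
  have hc2 : ∀ r i : ℕ, b⁻¹ ^ 2 ^ r * wm⁻¹ * (wm ^ 2)⁻¹ ^ i = (b ^ 2 ^ r * wm ^ (2 * i + 1))⁻¹ :=
    fun r i => by
      rw [mul_inv, inv_pow, inv_pow, ← pow_mul, pow_succ, mul_inv]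
      ring
  simp only [Nat.cast_pow, Nat.cast_ofNat, ← hc1] at hmin1
  simp only [Nat.cast_pow, Nat.cast_ofNat, ← hc2] at hmin2
  refine ⟨wm, wm ^ 2, hwm, hwm1, isMinIdem_iff_of_annihilator_eq_zero ?_ ?_⟩
  · rintro E (⟨i, -, rfl⟩ | ⟨r, hr, hrs, i, -, rfl⟩)
    · exact (hmin1 i).1
    · exact (hmin2 r i hr hrs).1
  · intro e he
    obtain ⟨p, rfl⟩ := AdjoinRoot.mk_surjective e
    have hp1 : ∀ i < 2 ^ m, _ := fun i hi => (hmin1 i).2 p (he _ (Or.inl ⟨i, hi, rfl⟩))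
    have hp2 : ∀ r i, 1 ≤ r → r ≤ s - m → i < 2 ^ (m - 1) → _ := fun r i hr hrs hi =>
      (hmin2 r i hr hrs).2 p (he _ (Or.inr ⟨r, hr, hrs, i, hi, rfl⟩))
    rw [AdjoinRoot.mk_eq_zero]
    refine X_pow_sub_C_dvd_of_forall_root (hpow2 n) ha fun x hx => ?_
    have hιb : ι b ≠ 0 := (map_ne_zero ι).mpr hb
    have hy : (x ^ 2 ^ (n - s) / ι b) ^ 2 ^ s = 1 := by
      rw [div_pow, ← pow_mul, ← pow_add, Nat.sub_add_cancel hsn, hx, ← map_pow, ← hab]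
      exact div_self ((map_ne_zero ι).mpr ha)
    rcases exists_pow_two_pow_eq_primitiveRoot_pow (by omega) hms.le (hprim m) hy with
      ⟨i, hi, hxi⟩ | ⟨r, hr, hrs, i, hi, hxi⟩
    · refine Polynomial.aeval_eq_zero_of_dvd_aeval_eq_zero (hp1 i hi) ?_
      rw [div_eq_iff hιb, ← hwm] at hxi
      simp [hxi, ← hι, mul_comm]
    · refine Polynomial.aeval_eq_zero_of_dvd_aeval_eq_zero (hp2 r i hr hrs hi) ?_
      rw [div_pow, div_eq_iff (pow_ne_zero _ hιb), ← hwm, ← pow_mul, ← pow_add] at hxi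
      simp [hxi, ← hι, mul_comm]
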